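/- Let k ∈ {0,1,2}, let A : [t₀,∞) → M_m(ℝ) be of class C¹ and B : [t₀,∞) → M_m(ℝ) continuous. The system ẍ + A(t)ẋ + B(t)x = 0 is L_k-equivalent to some system ξ̈ + V(t)ξ̇ + W(t)ξ = 0 with V, W continuous, V(t) = V(t)ᵀ and W(t) = W(t)ᵀ for all t ≥ t₀, if and only if there exist a symmetric C¹ matrix function S : [t₀,∞) → M_m(ℝ) and a symmetric positive definite S₀ ∈ M_m(ℝ) such that, setting Λ(t) = 2∫_{t₀}^t S(ν) dν + S₀ and K(t) = (Λ(t)A(t)ᵀ − A(t)Λ(t))/4, the following hold: (1) there exist μ > 0, η > 0 with |tr(Λ(t))| ≤ μ² and det(Λ(t)) ≥ η² for all t ≥ t₀; (2) if k ≥ 1, then sup_{t≥t₀} ‖(d^i/dt^i)K(t)‖ + sup_{t≥t₀} ‖(d^i/dt^i)S(t)‖ < ∞ for every 0 ≤ i ≤ k−1; (3) Λ(t)M(t)ᵀ = M(t)Λ(t) for all t ≥ t₀, where M(t) = (1/2)Ȧ(t) + (1/4)A(t)² − B(t). -/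

import Mathlib

open Matrix Set intervalIntegral

attribute [local instance] Matrix.frobeniusNormedAddCommGroup Matrix.frobeniusNormedSpace

/-- An `L_k`-matrix on `[t₀,∞)`: a `C²` matrix function with `|det L(t)| ≥ η > 0` and
`sup_{t ≥ t₀} ‖(dⁱ/dtⁱ)L(t)‖ < ∞` for every `0 ≤ i ≤ k`. -/
def IsLkMatrix (t₀ : ℝ) (k : ℕ) {m : ℕ} (L : ℝ → Matrix (Fin m) (Fin m) ℝ) : Prop :=
  ContDiffOn ℝ 2 L (Ici t₀) ∧
  (∃ η > (0:ℝ), ∀ t ∈ Ici t₀, η ≤ |(L t).det|) ∧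
  (∀ i ≤ k, ∃ M : ℝ, ∀ t ∈ Ici t₀, ‖iteratedDerivWithin i L (Ici t₀) t‖ ≤ M)

/-- The system `ẍ + A(t)ẋ + B(t)x = 0` is `L_k`-equivalent to `ξ̈ + V(t)ξ̇ + W(t)ξ = 0`:
there is an `L_k`-matrix `L` with `V(t) = L(t)⁻¹(2L̇(t) + A(t)L(t))` and
`W(t) = L(t)⁻¹(L̈(t) + A(t)L̇(t) + B(t)L(t))` for all `t ≥ t₀`. -/
def LkEquiv (t₀ : ℝ) (k : ℕ) {m : ℕ} (A B V W : ℝ → Matrix (Fin m) (Fin m) ℝ) : Prop :=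
  ∃ L : ℝ → Matrix (Fin m) (Fin m) ℝ, IsLkMatrix t₀ k L ∧
    ∀ t ∈ Ici t₀,
      V t = (L t)⁻¹ * ((2:ℝ) • derivWithin L (Ici t₀) t + A t * L t) ∧
      W t = (L t)⁻¹ * (derivWithin (derivWithin L (Ici t₀)) (Ici t₀) t
              + A t * derivWithin L (Ici t₀) t + B t * L t)

/-- `Λ(t) = 2∫_{t₀}^t S(ν) dν + S₀`. -/
noncomputable def Lam (t₀ : ℝ) {m : ℕ} (S : ℝ → Matrix (Fin m) (Fin m) ℝ)
    (S₀ : Matrix (Fin m) (Fin m) ℝ) (t : ℝ) : Matrix (Fin m) (Fin m) ℝ :=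
  (2:ℝ) • (∫ ν in t₀..t, S ν) + S₀

/-- A linear differential equation with coefficients continuous on `[t₀,∞)` has a solution on all
of `[t₀,∞)`, found as the fixed point of a contraction in a weighted sup norm. -/
theorem exists_hasDerivWithinAt_Ici_of_linear {E : Type*} [NormedAddCommGroup E] [NormedSpace ℝ E]
    [CompleteSpace E] (t₀ : ℝ) (P : ℝ → E →L[ℝ] E) (hP : ContinuousOn P (Ici t₀)) (x₀ : E) :
    ∃ x : ℝ → E, x t₀ = x₀ ∧ ∀ t ∈ Ici t₀, HasDerivWithinAt x (P t (x t)) (Ici t₀) t := by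
  set Q : ℝ → E →L[ℝ] E := fun t => P (max t t₀) with hQdef
  have hQ : Continuous Q :=
    hP.comp_continuous (continuous_id.max continuous_const) fun t => mem_Ici.2 (le_max_right _ _)
  set φ : ℝ → ℝ := fun t => ∫ s in t₀..t, 2 * ‖Q s‖ with hφdef
  have hφ' : ∀ t, HasDerivAt φ (2 * ‖Q t‖) t := fun t =>
    (hQ.norm.const_mul 2).integral_hasStrictDerivAt t₀ t |>.hasDerivAt
  have hφc : Continuous φ := continuous_iff_continuousAt.2 fun t => (hφ' t).continuousAt
  have hφ0 : φ t₀ = 0 := integral_same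
  have hφpos : ∀ t, t₀ ≤ t → 0 ≤ φ t := fun t ht =>
    integral_nonneg ht fun s _ => by positivity
  set g : (ℝ → E) → ℝ → E := fun y t => ∫ s in t₀..t, Real.exp (φ s) • Q s (y s) with hgdef
  have hcont : ∀ y : ℝ → E, Continuous y → Continuous fun s => Real.exp (φ s) • Q s (y s) :=
    fun y hy => (Real.continuous_exp.comp hφc).smul (hQ.clm_apply hy)
  have hg' : ∀ y : ℝ → E, Continuous y → ∀ t,
      HasDerivAt (g y) (Real.exp (φ t) • Q t (y t)) t := fun y hy t =>
    ((hcont y hy).integral_hasStrictDerivAt t₀ t).hasDerivAt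
  have hgc : ∀ y : ℝ → E, Continuous y → Continuous (g y) := fun y hy =>
    continuous_iff_continuousAt.2 fun t => (hg' y hy t).continuousAt
  have hbound : ∀ (y : ℝ → E) (C : ℝ), Continuous y → (∀ t, ‖y t‖ ≤ C) → ∀ t, t₀ ≤ t →
      ‖Real.exp (-φ t) • g y t‖ ≤ 1 / 2 * C := by
    intro y C hy hC t ht
    have hC0 : 0 ≤ C := (norm_nonneg _).trans (hC t)
    have hder : ∀ s, HasDerivAt (fun s => C / 2 * Real.exp (φ s))
        (Real.exp (φ s) * (‖Q s‖ * C)) s := fun s => by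
      exact (((hφ' s).exp).const_mul (C / 2)).congr_deriv (by ring)
    have hcont' : Continuous fun s => Real.exp (φ s) * (‖Q s‖ * C) :=
      (Real.continuous_exp.comp hφc).mul (hQ.norm.mul continuous_const)
    have h1 : ‖g y t‖ ≤ ∫ s in t₀..t, Real.exp (φ s) * (‖Q s‖ * C) := by
      refine norm_integral_le_of_norm_le ht (MeasureTheory.ae_of_all _ fun s _ => ?_)
        (hcont'.intervalIntegrable _ _)
      rw [norm_smul, Real.norm_eq_abs, Real.abs_exp]
      gcongr
      exact (Q s).le_opNorm_of_le (hC s)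
    rw [integral_eq_sub_of_hasDerivAt (fun s _ => hder s) (hcont'.intervalIntegrable _ _), hφ0,
      Real.exp_zero, mul_one] at h1
    rw [norm_smul, Real.norm_eq_abs, Real.abs_exp]
    have h2 : Real.exp (-φ t) * Real.exp (φ t) = 1 := by rw [← Real.exp_add]; simp
    calc Real.exp (-φ t) * ‖g y t‖ ≤ Real.exp (-φ t) * (C / 2 * Real.exp (φ t)) := by
          gcongr; linarith
      _ = 1 / 2 * C := by linear_combination C / 2 * h2
  have hmax : Continuous fun t : ℝ => max t t₀ := continuous_id.max continuous_const
  set T : BoundedContinuousFunction ℝ E → BoundedContinuousFunction ℝ E := fun y =>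
    BoundedContinuousFunction.ofNormedAddCommGroup
      (fun t => Real.exp (-φ (max t t₀)) • (x₀ + g y (max t t₀)))
      ((Real.continuous_exp.comp (hφc.comp hmax).neg).smul
        (continuous_const.add ((hgc y y.continuous).comp hmax)))
      (‖x₀‖ + 1 / 2 * ‖y‖) (fun t => by
        rw [smul_add]
        refine (norm_add_le _ _).trans (add_le_add ?_
          (hbound y _ y.continuous y.norm_coe_le_norm _ (le_max_right _ _)))
        rw [norm_smul, Real.norm_eq_abs, Real.abs_exp]
        exact mul_le_of_le_one_left (norm_nonneg _)
          (Real.exp_le_one_iff.2 (neg_nonpos.2 (hφpos _ (le_max_right _ _))))) with hTdef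
  have hT : ContractingWith (1 / 2) T := by
    refine ⟨by norm_num, LipschitzWith.of_dist_le_mul fun y z => ?_⟩
    refine (BoundedContinuousFunction.dist_le (by positivity)).2 fun t => ?_
    have hsub : g y (max t t₀) - g z (max t t₀) = g (fun s => y s - z s) (max t t₀) := by
      rw [hgdef]
      dsimp only
      rw [← integral_sub ((hcont y y.continuous).intervalIntegrable _ _)
        ((hcont z z.continuous).intervalIntegrable _ _)]
      simp only [map_sub, smul_sub]
    have hTt : dist (T y t) (T z t)
        = ‖Real.exp (-φ (max t t₀)) • g (fun s => y s - z s) (max t t₀)‖ := by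
      rw [← hsub, dist_eq_norm]
      simp [hTdef, ← smul_sub]
    rw [hTt]
    simpa using hbound (fun s => y s - z s) (dist y z) (y.continuous.sub z.continuous)
      (fun s => by rw [← dist_eq_norm]; exact BoundedContinuousFunction.dist_coe_le_dist s)
      _ (le_max_right t t₀)
  obtain ⟨y, hy⟩ : ∃ y, T y = y := ⟨hT.fixedPoint T, hT.fixedPoint_isFixedPt⟩
  have hyt : ∀ t, t₀ ≤ t → Real.exp (φ t) • y t = x₀ + g y t := fun t ht => by
    conv_lhs => rw [← hy]
    simp [hTdef, max_eq_left ht, smul_smul, ← Real.exp_add]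
  refine ⟨fun t => x₀ + g y t, by simp [hgdef], fun t ht => ?_⟩
  have := ((hg' y y.continuous t).const_add x₀).hasDerivWithinAt (s := Ici t₀)
  have hQt : Q t = P t := congrArg P (max_eq_left ht)
  rwa [← map_smul, hyt t ht, hQt] at this

/-- A function on `[t₀,∞)` that vanishes at `t₀` and satisfies `‖ẋ‖ ≤ c‖x‖`, with `c` continuous,
vanishes identically. -/
theorem eq_zero_of_hasDerivWithinAt_Ici_of_norm_le {E : Type*} [NormedAddCommGroup E]
    [NormedSpace ℝ E] {t₀ : ℝ} {x x' : ℝ → E} {c : ℝ → ℝ} (hc : ContinuousOn c (Ici t₀))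
    (hx : ∀ t ∈ Ici t₀, HasDerivWithinAt x (x' t) (Ici t₀) t)
    (hbound : ∀ t ∈ Ici t₀, ‖x' t‖ ≤ c t * ‖x t‖) (hx₀ : x t₀ = 0) :
    ∀ t ∈ Ici t₀, x t = 0 := by
  intro t ht
  obtain ⟨C, hC⟩ := isCompact_Icc.exists_bound_of_continuousOn
    (hc.mono (Icc_subset_Ici_self : Icc t₀ t ⊆ Ici t₀))
  have hcont : ContinuousOn x (Icc t₀ t) := fun s hs =>
    ((hx s hs.1).continuousWithinAt).mono Icc_subset_Ici_self
  have := norm_le_gronwallBound_of_norm_deriv_right_le (δ := 0) (K := C) (ε := 0) hcont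
    (fun s hs => (hx s hs.1).mono (Ici_subset_Ici.2 hs.1)) (by simp [hx₀])
    (fun s hs => by
      rw [add_zero]
      exact (hbound s hs.1).trans (mul_le_mul_of_nonneg_right
        ((le_abs_self _).trans (hC s (Ico_subset_Icc_self hs))) (norm_nonneg _))) t ⟨ht, le_rfl⟩
  rwa [gronwallBound_ε0_δ0, norm_le_zero_iff] at this

section FrobeniusNormedRing

variable {n : Type*} [Fintype n] [DecidableEq n] {s : Set ℝ} {t : ℝ}

attribute [local instance] Matrix.frobeniusNormedRing Matrix.frobeniusNormedAlgebra

theorem HasDerivWithinAt.matrix_mul {X Y : ℝ → Matrix n n ℝ} {X' Y' : Matrix n n ℝ}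
    (hX : HasDerivWithinAt X X' s t) (hY : HasDerivWithinAt Y Y' s t) :
    HasDerivWithinAt (fun t => X t * Y t) (X' * Y t + X t * Y') s t :=
  hX.mul hY

theorem ContDiffOn.matrix_mul {r : WithTop ℕ∞} {X Y : ℝ → Matrix n n ℝ}
    (hX : ContDiffOn ℝ r X s) (hY : ContDiffOn ℝ r Y s) :
    ContDiffOn ℝ r (fun t => X t * Y t) s :=
  hX.mul hY

theorem ContDiffOn.matrix_inv {r : WithTop ℕ∞} {X : ℝ → Matrix n n ℝ}
    (hX : ContDiffOn ℝ r X s) (h : ∀ t ∈ s, IsUnit (X t).det) :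
    ContDiffOn ℝ r (fun t => (X t)⁻¹) s := by
  intro t ht
  obtain ⟨u, hu⟩ := (Matrix.isUnit_iff_isUnit_det _).2 (h t ht)
  have := contDiffAt_ringInverse ℝ (n := r) u
  rw [hu] at this
  simp only [Matrix.nonsing_inv_eq_ringInverse]
  exact this.comp_contDiffWithinAt t (hX t ht)

end FrobeniusNormedRing

section MatrixCalculus

variable {n : Type*} [Fintype n] {s : Set ℝ} {t : ℝ}

theorem ContinuousOn.matrix_mul {X Y : ℝ → Matrix n n ℝ}
    (hX : ContinuousOn X s) (hY : ContinuousOn Y s) : ContinuousOn (fun t => X t * Y t) s :=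
  hX.mul hY

theorem HasDerivWithinAt.matrix_transpose {X : ℝ → Matrix n n ℝ} {X' : Matrix n n ℝ}
    (hX : HasDerivWithinAt X X' s t) : HasDerivWithinAt (fun t => (X t)ᵀ) X'ᵀ s t :=
  (Matrix.transposeLinearEquiv n n ℝ ℝ).toLinearMap.toContinuousLinearMap.hasFDerivAt
    |>.comp_hasDerivWithinAt t hX

theorem ContDiffOn.matrix_transpose {r : WithTop ℕ∞} {X : ℝ → Matrix n n ℝ}
    (hX : ContDiffOn ℝ r X s) : ContDiffOn ℝ r (fun t => (X t)ᵀ) s :=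
  (Matrix.transposeLinearEquiv n n ℝ ℝ).toLinearMap.toContinuousLinearMap.contDiff
    |>.comp_contDiffOn hX

/-- Matrix multiplication as a continuous bilinear map. -/
noncomputable def Matrix.mulCLM (n : Type*) [Fintype n] :
    Matrix n n ℝ →L[ℝ] Matrix n n ℝ →L[ℝ] Matrix n n ℝ :=
  LinearMap.toContinuousLinearMap
    ((LinearMap.toContinuousLinearMap : _ ≃ₗ[ℝ] _).toLinearMap ∘ₗ LinearMap.mul ℝ (Matrix n n ℝ))

theorem Matrix.frobenius_norm_sq_eq_trace (X : Matrix n n ℝ) : ‖X‖ ^ 2 = (X * Xᵀ).trace := by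
  have h0 : 0 ≤ ∑ i, ∑ j, ‖X i j‖ ^ (2 : ℝ) := by positivity
  rw [Matrix.frobenius_norm_def, ← Real.rpow_natCast, ← Real.rpow_mul h0]
  simp [Matrix.trace, Matrix.mul_apply, pow_two]

end MatrixCalculus

open scoped MatrixOrder in
theorem Matrix.PosSemidef.exists_mul_transpose_self {n : Type*} [Fintype n] [DecidableEq n]
    {X : Matrix n n ℝ} (hX : X.PosSemidef) : ∃ C : Matrix n n ℝ, C * Cᵀ = X := by
  obtain ⟨C, rfl⟩ := CStarAlgebra.nonneg_iff_eq_star_mul_self.mp hX.nonneg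
  exact ⟨Cᵀ, by simp [Matrix.star_eq_conjTranspose]⟩

theorem Matrix.posDef_mul_transpose_self {n : Type*} [Fintype n] [DecidableEq n]
    {X : Matrix n n ℝ} (hX : IsUnit X.det) : (X * Xᵀ).PosDef := by
  rw [← Matrix.conjTranspose_eq_transpose_of_trivial]
  exact Matrix.PosDef.mul_conjTranspose_self X
    (Matrix.vecMul_injective_of_isUnit ((Matrix.isUnit_iff_isUnit_det X).2 hX))

theorem Matrix.isSymm_inv_mul_iff {n : Type*} [Fintype n] [DecidableEq n]
    {X Y : Matrix n n ℝ} (hX : IsUnit X.det) : (X⁻¹ * Y)ᵀ = X⁻¹ * Y ↔ X * Yᵀ = Y * Xᵀ := by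
  have hXt : IsUnit Xᵀ.det := by rwa [Matrix.det_transpose]
  rw [Matrix.transpose_mul, Matrix.transpose_nonsing_inv]
  constructor
  · intro h
    calc X * Yᵀ = X * (Yᵀ * Xᵀ⁻¹) * Xᵀ := by
          simp only [Matrix.mul_assoc, Matrix.nonsing_inv_mul _ hXt, Matrix.mul_one]
      _ = Y * Xᵀ := by rw [h, Matrix.mul_nonsing_inv_cancel_left _ _ hX]
  · intro h
    calc Yᵀ * Xᵀ⁻¹ = X⁻¹ * (X * Yᵀ) * Xᵀ⁻¹ := by rw [Matrix.nonsing_inv_mul_cancel_left _ _ hX]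
      _ = X⁻¹ * Y := by
          simp only [h, Matrix.mul_assoc, Matrix.mul_nonsing_inv _ hXt, Matrix.mul_one]

section BoundedMatrixFunctions

/-- `X` is bounded in norm on `s`. -/
def NormBddOn {E : Type*} [Norm E] (s : Set ℝ) (X : ℝ → E) : Prop := ∃ M : ℝ, ∀ t ∈ s, ‖X t‖ ≤ M

variable {m : ℕ} {s : Set ℝ} {X Y : ℝ → Matrix (Fin m) (Fin m) ℝ}

theorem NormBddOn.congr {E : Type*} [Norm E] {X Y : ℝ → E} (hX : NormBddOn s X)
    (h : EqOn Y X s) : NormBddOn s Y :=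
  hX.imp fun _ hM t ht => (congrArg norm (h ht)).trans_le (hM t ht)

theorem NormBddOn.add (hX : NormBddOn s X) (hY : NormBddOn s Y) :
    NormBddOn s fun t => X t + Y t := by
  obtain ⟨M, hM⟩ := hX
  obtain ⟨N, hN⟩ := hY
  exact ⟨M + N, fun t ht => norm_add_le_of_le (hM t ht) (hN t ht)⟩

theorem NormBddOn.const_smul (hX : NormBddOn s X) (c : ℝ) : NormBddOn s fun t => c • X t := by
  obtain ⟨M, hM⟩ := hX
  refine ⟨‖c‖ * M, fun t ht => ?_⟩
  rw [norm_smul]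
  exact mul_le_mul_of_nonneg_left (hM t ht) (norm_nonneg c)

theorem NormBddOn.sub (hX : NormBddOn s X) (hY : NormBddOn s Y) :
    NormBddOn s fun t => X t - Y t := by
  obtain ⟨M, hM⟩ := hX
  obtain ⟨N, hN⟩ := hY
  exact ⟨M + N, fun t ht => norm_sub_le_of_le (hM t ht) (hN t ht)⟩

theorem NormBddOn.matrix_mul (hX : NormBddOn s X) (hY : NormBddOn s Y) :
    NormBddOn s fun t => X t * Y t := by
  obtain ⟨M, hM⟩ := hX
  obtain ⟨N, hN⟩ := hY
  exact ⟨M * N, fun t ht => (Matrix.frobenius_norm_mul _ _).trans <|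
    mul_le_mul (hM t ht) (hN t ht) (norm_nonneg _) ((norm_nonneg _).trans (hM t ht))⟩

theorem NormBddOn.matrix_transpose (hX : NormBddOn s X) : NormBddOn s fun t => (X t)ᵀ := by
  obtain ⟨M, hM⟩ := hX
  exact ⟨M, fun t ht => (Matrix.frobenius_norm_transpose _).trans_le (hM t ht)⟩

theorem NormBddOn.matrix_inv (hX : NormBddOn s X) {η : ℝ} (hη : 0 < η)
    (hdet : ∀ t ∈ s, η ≤ |(X t).det|) : NormBddOn s fun t => (X t)⁻¹ := by
  obtain ⟨M, hM⟩ := hX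
  have hproper : ProperSpace (Matrix (Fin m) (Fin m) ℝ) := FiniteDimensional.proper_real _
  obtain ⟨N, hN⟩ := (isCompact_closedBall (0 : Matrix (Fin m) (Fin m) ℝ) M)
    |>.exists_bound_of_continuousOn (f := fun X => X.adjugate)
      (continuous_id.matrix_adjugate.continuousOn)
  refine ⟨η⁻¹ * N, fun t ht => ?_⟩
  beta_reduce
  rw [Matrix.inv_def, norm_smul, Ring.inverse_eq_inv', norm_inv, Real.norm_eq_abs]
  exact mul_le_mul (inv_anti₀ hη (hdet t ht)) (hN _ (by simpa using hM t ht)) (norm_nonneg _)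
    (inv_nonneg.2 hη.le)

theorem normBddOn_iff_mul_transpose_trace :
    NormBddOn s X ↔ ∃ μ > (0 : ℝ), ∀ t ∈ s, |(X t * (X t)ᵀ).trace| ≤ μ ^ 2 := by
  have hsq : ∀ t, |(X t * (X t)ᵀ).trace| = ‖X t‖ ^ 2 := fun t => by
    rw [← Matrix.frobenius_norm_sq_eq_trace, abs_sq]
  simp only [hsq]
  constructor
  · rintro ⟨M, hM⟩
    exact ⟨|M| + 1, by positivity, fun t ht => pow_le_pow_left₀ (norm_nonneg _)
      ((hM t ht).trans ((le_abs_self M).trans (le_add_of_nonneg_right zero_le_one))) 2⟩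
  · rintro ⟨μ, hμ, h⟩
    exact ⟨μ, fun t ht => le_of_sq_le_sq (h t ht) hμ.le⟩

end BoundedMatrixFunctions

section DerivWithin

variable {m : ℕ} {t₀ : ℝ}

theorem ContDiffOn.hasDerivWithinAt_Ici {X : ℝ → Matrix (Fin m) (Fin m) ℝ}
    (hX : ContDiffOn ℝ 1 X (Ici t₀)) :
    ∀ t ∈ Ici t₀, HasDerivWithinAt X (derivWithin X (Ici t₀) t) (Ici t₀) t := fun t ht =>
  (hX.differentiableOn one_ne_zero t ht).hasDerivWithinAt

theorem ContDiffOn.derivWithin_Ici {X : ℝ → Matrix (Fin m) (Fin m) ℝ}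
    (hX : ContDiffOn ℝ 2 X (Ici t₀)) : ContDiffOn ℝ 1 (derivWithin X (Ici t₀)) (Ici t₀) :=
  hX.derivWithin (uniqueDiffOn_Ici t₀) (by norm_num)

theorem derivWithin_eqOn_Ici {X Y Y' : ℝ → Matrix (Fin m) (Fin m) ℝ} (h : EqOn X Y (Ici t₀))
    (hY : ∀ t ∈ Ici t₀, HasDerivWithinAt Y (Y' t) (Ici t₀) t) :
    EqOn (derivWithin X (Ici t₀)) Y' (Ici t₀) := fun t ht =>
  (derivWithin_congr h (h ht)).trans ((hY t ht).derivWithin (uniqueDiffOn_Ici t₀ t ht))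

end DerivWithin

section Lam

variable {m : ℕ} {t₀ : ℝ} {S : ℝ → Matrix (Fin m) (Fin m) ℝ} {S₀ : Matrix (Fin m) (Fin m) ℝ}

theorem Lam_self : Lam t₀ S S₀ t₀ = S₀ := by
  simp [Lam]

theorem hasDerivWithinAt_Lam (hS : ContinuousOn S (Ici t₀)) :
    ∀ t ∈ Ici t₀, HasDerivWithinAt (Lam t₀ S S₀) ((2 : ℝ) • S t) (Ici t₀) t := by
  intro t ht
  have hc : Continuous fun τ => S (max τ t₀) :=
    hS.comp_continuous (continuous_id.max continuous_const) fun τ => mem_Ici.2 (le_max_right _ _)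
  have heq : EqOn (Lam t₀ S S₀) (Lam t₀ (fun τ => S (max τ t₀)) S₀) (Ici t₀) := by
    intro τ hτ
    simp only [Lam]
    congr 2
    refine integral_congr fun ν hν => ?_
    rw [uIcc_of_le hτ] at hν
    simp only [max_eq_left hν.1]
  have hd := (((hc.integral_hasStrictDerivAt t₀ t).hasDerivAt.const_smul (2 : ℝ)).add_const S₀)
    |>.hasDerivWithinAt (s := Ici t₀)
  rw [max_eq_left (mem_Ici.1 ht)] at hd
  exact hd.congr heq (heq ht)

theorem Lam_eqOn_of_hasDerivWithinAt (hS : ContinuousOn S (Ici t₀))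
    {F : ℝ → Matrix (Fin m) (Fin m) ℝ} (hF₀ : F t₀ = S₀)
    (hF : ∀ t ∈ Ici t₀, HasDerivWithinAt F ((2 : ℝ) • S t) (Ici t₀) t) :
    EqOn (Lam t₀ S S₀) F (Ici t₀) := fun t ht =>
  sub_eq_zero.1 <| eq_zero_of_hasDerivWithinAt_Ici_of_norm_le (c := fun _ => 0)
    (x := fun t => Lam t₀ S S₀ t - F t) continuousOn_const
    (fun τ hτ => (hasDerivWithinAt_Lam hS τ hτ).sub (hF τ hτ)) (fun τ _ => by simp)
    (by rw [Lam_self, hF₀, sub_self]) t ht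

theorem transpose_Lam (hS : ContinuousOn S (Ici t₀)) (hSsymm : ∀ t ∈ Ici t₀, (S t)ᵀ = S t)
    (hS₀ : S₀ᵀ = S₀) : ∀ t ∈ Ici t₀, (Lam t₀ S S₀ t)ᵀ = Lam t₀ S S₀ t := fun t ht =>
  (Lam_eqOn_of_hasDerivWithinAt hS (F := fun t => (Lam t₀ S S₀ t)ᵀ) (by rw [Lam_self, hS₀])
    (fun τ hτ => ((hasDerivWithinAt_Lam hS τ hτ).matrix_transpose).congr_deriv
      (by rw [Matrix.transpose_smul, hSsymm τ hτ])) ht).symm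

end Lam

section SymmetricCoefficients

variable {m : ℕ}

/-- The new damping matrix `L⁻¹(2L̇ + AL)` is symmetric iff the skew part of `L̇Lᵀ` is `K`. -/
theorem isSymm_damping_iff {L L' A : Matrix (Fin m) (Fin m) ℝ} (hL : IsUnit L.det) :
    (L⁻¹ * ((2 : ℝ) • L' + A * L))ᵀ = L⁻¹ * ((2 : ℝ) • L' + A * L) ↔
      L' * Lᵀ - L * L'ᵀ = (1 / 2 : ℝ) • (L * Lᵀ * Aᵀ - A * (L * Lᵀ)) := by
  rw [Matrix.isSymm_inv_mul_iff hL]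
  simp only [transpose_add, transpose_smul, transpose_mul, mul_add, add_mul, Matrix.mul_smul,
    Matrix.smul_mul, Matrix.mul_assoc]
  constructor <;> intro h
  · linear_combination (norm := module) (-1 / 2 : ℝ) • h
  · linear_combination (norm := module) (-2 : ℝ) • h

/-- The symmetry of the new stiffness matrix `L⁻¹(L̈ + AL̇ + BL)`, once the new damping matrix is
symmetric; the hypothesis `h'` is the derivative of `h`. -/
theorem isSymm_stiffness_iff {L L' L'' A A' B : Matrix (Fin m) (Fin m) ℝ} (hL : IsUnit L.det)
    (h : L' * Lᵀ - L * L'ᵀ = (1 / 2 : ℝ) • (L * Lᵀ * Aᵀ - A * (L * Lᵀ)))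
    (h' : L'' * Lᵀ - L * L''ᵀ = (1 / 2 : ℝ) • ((L' * Lᵀ + L * L'ᵀ) * Aᵀ + L * Lᵀ * A'ᵀ
      - (A' * (L * Lᵀ) + A * (L' * Lᵀ + L * L'ᵀ)))) :
    (L⁻¹ * (L'' + A * L' + B * L))ᵀ = L⁻¹ * (L'' + A * L' + B * L) ↔
      L * Lᵀ * ((1 / 2 : ℝ) • A' + (1 / 4 : ℝ) • (A ^ 2) - B)ᵀ
        = ((1 / 2 : ℝ) • A' + (1 / 4 : ℝ) • (A ^ 2) - B) * (L * Lᵀ) := by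
  rw [Matrix.isSymm_inv_mul_iff hL]
  have h₁ := congrArg (· * Aᵀ) h
  have h₂ := congrArg (A * ·) h
  simp only [pow_two, transpose_add, transpose_sub, transpose_smul, transpose_mul, mul_add, add_mul,
    mul_sub, sub_mul, Matrix.mul_smul, Matrix.smul_mul, Matrix.mul_assoc] at h' h₁ h₂ ⊢
  constructor <;> intro h₀
  · linear_combination (norm := module) -h₀ - h' - (1 / 2 : ℝ) • h₁ - (1 / 2 : ℝ) • h₂
  · linear_combination (norm := module) -h₀ - h' - (1 / 2 : ℝ) • h₁ - (1 / 2 : ℝ) • h₂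

end SymmetricCoefficients

section Factorization

variable {m : ℕ} {t₀ : ℝ} {L A S : ℝ → Matrix (Fin m) (Fin m) ℝ}
  {S₀ : Matrix (Fin m) (Fin m) ℝ}

theorem hasDerivWithinAt_mul_transpose_self (hL : ContDiffOn ℝ 2 L (Ici t₀)) :
    ∀ t ∈ Ici t₀, HasDerivWithinAt (fun t => L t * (L t)ᵀ)
      (derivWithin L (Ici t₀) t * (L t)ᵀ + L t * (derivWithin L (Ici t₀) t)ᵀ) (Ici t₀) t := by
  intro t ht
  have h := (hL.of_le one_le_two).hasDerivWithinAt_Ici t ht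
  exact h.matrix_mul h.matrix_transpose

theorem hasDerivWithinAt_derivWithin_mul_transpose (hL : ContDiffOn ℝ 2 L (Ici t₀)) :
    ∀ t ∈ Ici t₀, HasDerivWithinAt (fun t => derivWithin L (Ici t₀) t * (L t)ᵀ)
      (derivWithin (derivWithin L (Ici t₀)) (Ici t₀) t * (L t)ᵀ
        + derivWithin L (Ici t₀) t * (derivWithin L (Ici t₀) t)ᵀ) (Ici t₀) t := by
  intro t ht
  exact (hL.derivWithin_Ici.hasDerivWithinAt_Ici t ht).matrix_mul
    ((hL.of_le one_le_two).hasDerivWithinAt_Ici t ht).matrix_transpose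

theorem hasDerivWithinAt_mul_transpose_derivWithin (hL : ContDiffOn ℝ 2 L (Ici t₀)) :
    ∀ t ∈ Ici t₀, HasDerivWithinAt (fun t => L t * (derivWithin L (Ici t₀) t)ᵀ)
      (derivWithin L (Ici t₀) t * (derivWithin L (Ici t₀) t)ᵀ
        + L t * (derivWithin (derivWithin L (Ici t₀)) (Ici t₀) t)ᵀ) (Ici t₀) t := by
  intro t ht
  exact ((hL.of_le one_le_two).hasDerivWithinAt_Ici t ht).matrix_mul
    (hL.derivWithin_Ici.hasDerivWithinAt_Ici t ht).matrix_transpose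

/-- The derivative of the skew part relation between `L` and `A`. -/
theorem derivWithin_skew_relation (hL : ContDiffOn ℝ 2 L (Ici t₀)) (hA : ContDiffOn ℝ 1 A (Ici t₀))
    (h : ∀ t ∈ Ici t₀, derivWithin L (Ici t₀) t * (L t)ᵀ - L t * (derivWithin L (Ici t₀) t)ᵀ
      = (1 / 2 : ℝ) • (L t * (L t)ᵀ * (A t)ᵀ - A t * (L t * (L t)ᵀ))) :
    ∀ t ∈ Ici t₀, derivWithin (derivWithin L (Ici t₀)) (Ici t₀) t * (L t)ᵀ
        - L t * (derivWithin (derivWithin L (Ici t₀)) (Ici t₀) t)ᵀ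
      = (1 / 2 : ℝ) • ((derivWithin L (Ici t₀) t * (L t)ᵀ
            + L t * (derivWithin L (Ici t₀) t)ᵀ) * (A t)ᵀ
          + L t * (L t)ᵀ * (derivWithin A (Ici t₀) t)ᵀ
          - (derivWithin A (Ici t₀) t * (L t * (L t)ᵀ)
            + A t * (derivWithin L (Ici t₀) t * (L t)ᵀ
              + L t * (derivWithin L (Ici t₀) t)ᵀ))) := by
  intro t ht
  have hA' := hA.hasDerivWithinAt_Ici t ht
  have hΛ := hasDerivWithinAt_mul_transpose_self hL t ht
  have hleft := (hasDerivWithinAt_derivWithin_mul_transpose hL t ht).sub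
    (hasDerivWithinAt_mul_transpose_derivWithin hL t ht)
  have hright := ((hΛ.matrix_mul hA'.matrix_transpose).sub (hA'.matrix_mul hΛ)).const_smul
    (1 / 2 : ℝ)
  have := (uniqueDiffOn_Ici t₀ t ht).eq_deriv _ hleft (hright.congr h (h t ht))
  rw [← this]
  abel

variable {K : ℝ → Matrix (Fin m) (Fin m) ℝ} {η : ℝ}

theorem eq_mul_transpose_inv (hη : 0 < η) (hdet : ∀ t ∈ Ici t₀, η ≤ |(L t).det|)
    {X Y : ℝ → Matrix (Fin m) (Fin m) ℝ}
    (h : ∀ t ∈ Ici t₀, X t * (L t)ᵀ = Y t) :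
    ∀ t ∈ Ici t₀, X t = Y t * (L t)⁻¹ᵀ := fun t ht => by
  have hu : IsUnit (L t)ᵀ.det := by
    rw [Matrix.det_transpose]
    exact isUnit_iff_ne_zero.2 (abs_pos.1 (hη.trans_le (hdet t ht)))
  rw [← h t ht, Matrix.transpose_nonsing_inv, Matrix.mul_nonsing_inv_cancel_right _ _ hu]

theorem normBddOn_derivWithin_iff
    (hK : EqOn K (fun t => (1 / 2 : ℝ) • (derivWithin L (Ici t₀) t * (L t)ᵀ
      - L t * (derivWithin L (Ici t₀) t)ᵀ)) (Ici t₀))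
    (hS : EqOn S (fun t => (1 / 2 : ℝ) • (derivWithin L (Ici t₀) t * (L t)ᵀ
      + L t * (derivWithin L (Ici t₀) t)ᵀ)) (Ici t₀))
    (hη : 0 < η) (hdet : ∀ t ∈ Ici t₀, η ≤ |(L t).det|) (hbdd : NormBddOn (Ici t₀) L) :
    NormBddOn (Ici t₀) (derivWithin L (Ici t₀)) ↔
      NormBddOn (Ici t₀) K ∧ NormBddOn (Ici t₀) S := by
  constructor
  · intro h
    have hP := h.matrix_mul hbdd.matrix_transpose
    have hPt := hbdd.matrix_mul h.matrix_transpose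
    exact ⟨((hP.sub hPt).const_smul _).congr hK, ((hP.add hPt).const_smul _).congr hS⟩
  · rintro ⟨h₁, h₂⟩
    refine ((h₂.add h₁).matrix_mul (hbdd.matrix_inv hη hdet).matrix_transpose).congr
      (eq_mul_transpose_inv hη hdet fun t ht => ?_)
    rw [hK ht, hS ht]
    module

theorem normBddOn_derivWithin_derivWithin_iff
    (hL : ContDiffOn ℝ 2 L (Ici t₀))
    (hK : EqOn K (fun t => (1 / 2 : ℝ) • (derivWithin L (Ici t₀) t * (L t)ᵀ
      - L t * (derivWithin L (Ici t₀) t)ᵀ)) (Ici t₀))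
    (hS : EqOn S (fun t => (1 / 2 : ℝ) • (derivWithin L (Ici t₀) t * (L t)ᵀ
      + L t * (derivWithin L (Ici t₀) t)ᵀ)) (Ici t₀))
    (hη : 0 < η) (hdet : ∀ t ∈ Ici t₀, η ≤ |(L t).det|) (hbdd : NormBddOn (Ici t₀) L)
    (hbdd' : NormBddOn (Ici t₀) (derivWithin L (Ici t₀))) :
    NormBddOn (Ici t₀) (derivWithin (derivWithin L (Ici t₀)) (Ici t₀)) ↔
      NormBddOn (Ici t₀) (derivWithin K (Ici t₀)) ∧
        NormBddOn (Ici t₀) (derivWithin S (Ici t₀)) := by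
  have hK' := derivWithin_eqOn_Ici hK fun t ht =>
    ((hasDerivWithinAt_derivWithin_mul_transpose hL t ht).sub
      (hasDerivWithinAt_mul_transpose_derivWithin hL t ht)).const_smul (1 / 2 : ℝ)
  have hS' := derivWithin_eqOn_Ici hS fun t ht =>
    ((hasDerivWithinAt_derivWithin_mul_transpose hL t ht).add
      (hasDerivWithinAt_mul_transpose_derivWithin hL t ht)).const_smul (1 / 2 : ℝ)
  have hQ := hbdd'.matrix_mul hbdd'.matrix_transpose
  constructor
  · intro h
    have hP := (h.matrix_mul hbdd.matrix_transpose).add hQ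
    have hPt := hQ.add (hbdd.matrix_mul h.matrix_transpose)
    exact ⟨((hP.sub hPt).const_smul _).congr hK', ((hP.add hPt).const_smul _).congr hS'⟩
  · rintro ⟨h₁, h₂⟩
    refine (((h₂.add h₁).sub hQ).matrix_mul (hbdd.matrix_inv hη hdet).matrix_transpose).congr
      (eq_mul_transpose_inv hη hdet fun t ht => ?_)
    rw [hK' ht, hS' ht]
    module

theorem normBddOn_iteratedDerivWithin_iff
    (hL : ContDiffOn ℝ 2 L (Ici t₀))
    (hK : EqOn K (fun t => (1 / 2 : ℝ) • (derivWithin L (Ici t₀) t * (L t)ᵀ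
      - L t * (derivWithin L (Ici t₀) t)ᵀ)) (Ici t₀))
    (hS : EqOn S (fun t => (1 / 2 : ℝ) • (derivWithin L (Ici t₀) t * (L t)ᵀ
      + L t * (derivWithin L (Ici t₀) t)ᵀ)) (Ici t₀))
    (hη : 0 < η) (hdet : ∀ t ∈ Ici t₀, η ≤ |(L t).det|)
    {k : ℕ} (hk : k = 0 ∨ k = 1 ∨ k = 2) :
    (∀ i ≤ k, NormBddOn (Ici t₀) (iteratedDerivWithin i L (Ici t₀))) ↔
      NormBddOn (Ici t₀) L ∧ (1 ≤ k → ∀ i < k,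
        NormBddOn (Ici t₀) (iteratedDerivWithin i K (Ici t₀)) ∧
          NormBddOn (Ici t₀) (iteratedDerivWithin i S (Ici t₀))) := by
  have h₁ := normBddOn_derivWithin_iff hK hS hη hdet
  have h₂ := normBddOn_derivWithin_derivWithin_iff hL hK hS hη hdet
  rcases hk with rfl | rfl | rfl
  · simp
  · have hle : ∀ p : ℕ → Prop, (∀ i ≤ 1, p i) ↔ p 0 ∧ p 1 := fun p =>
      ⟨fun h => ⟨h 0 (by omega), h 1 le_rfl⟩, fun h i hi => by interval_cases i <;> simp [h]⟩
    rw [hle, iteratedDerivWithin_one, iteratedDerivWithin_zero]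
    simp only [le_refl, true_imp_iff, Nat.lt_one_iff, forall_eq, iteratedDerivWithin_zero]
    exact and_congr_right h₁
  · have hle : ∀ p : ℕ → Prop, (∀ i ≤ 2, p i) ↔ p 0 ∧ p 1 ∧ p 2 := fun p =>
      ⟨fun h => ⟨h 0 (by omega), h 1 (by omega), h 2 le_rfl⟩,
        fun h i hi => by interval_cases i <;> simp [h]⟩
    have hlt : ∀ p : ℕ → Prop, (∀ i < 2, p i) ↔ p 0 ∧ p 1 := fun p =>
      ⟨fun h => ⟨h 0 (by omega), h 1 (by omega)⟩, fun h i hi => by interval_cases i <;> simp [h]⟩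
    have htwo : iteratedDerivWithin 2 L (Ici t₀)
        = derivWithin (derivWithin L (Ici t₀)) (Ici t₀) := by
      rw [iteratedDerivWithin_succ, iteratedDerivWithin_one]
      rfl
    rw [hle, hlt, htwo]
    simp only [one_le_two, true_imp_iff, iteratedDerivWithin_one, iteratedDerivWithin_zero]
    exact and_congr_right fun hb =>
      ⟨fun ⟨h, h'⟩ => ⟨(h₁ hb).1 h, (h₂ hb h).1 h'⟩,
        fun ⟨h, h'⟩ => ⟨(h₁ hb).2 h, (h₂ hb ((h₁ hb).2 h)).2 h'⟩⟩

end Factorization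

section Existence

variable {m : ℕ} {t₀ : ℝ}

/-- If `Λ` solves `Λ̇ = XΛ + ΛXᵀ` on `[t₀,∞)` and `Λ(t₀) = CCᵀ`, then `Λ = LLᵀ` for the solution `L`
of `L̇ = XL` with `L(t₀) = C`. -/
theorem exists_mul_transpose_self_eq {X Λ : ℝ → Matrix (Fin m) (Fin m) ℝ}
    (hX : ContDiffOn ℝ 1 X (Ici t₀))
    (hΛ : ∀ t ∈ Ici t₀, HasDerivWithinAt Λ (X t * Λ t + Λ t * (X t)ᵀ) (Ici t₀) t)
    (hΛ₀ : (Λ t₀).PosSemidef) :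
    ∃ L : ℝ → Matrix (Fin m) (Fin m) ℝ, ContDiffOn ℝ 2 L (Ici t₀) ∧
      (∀ t ∈ Ici t₀, derivWithin L (Ici t₀) t = X t * L t) ∧
      ∀ t ∈ Ici t₀, L t * (L t)ᵀ = Λ t := by
  obtain ⟨C, hC⟩ := hΛ₀.exists_mul_transpose_self
  have hXc : ContinuousOn (fun t => Matrix.mulCLM (Fin m) (X t)) (Ici t₀) :=
    (Matrix.mulCLM (Fin m)).continuous.comp_continuousOn hX.continuousOn
  obtain ⟨L, hL₀, hL⟩ : ∃ L : ℝ → Matrix (Fin m) (Fin m) ℝ, L t₀ = C ∧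
      ∀ t ∈ Ici t₀, HasDerivWithinAt L (X t * L t) (Ici t₀) t :=
    exists_hasDerivWithinAt_Ici_of_linear t₀ _ hXc C
  have hL' : EqOn (derivWithin L (Ici t₀)) (fun t => X t * L t) (Ici t₀) := fun t ht =>
    (hL t ht).derivWithin (uniqueDiffOn_Ici t₀ t ht)
  have hLd : DifferentiableOn ℝ L (Ici t₀) := fun t ht => (hL t ht).differentiableWithinAt
  have hL1 : ContDiffOn ℝ 1 L (Ici t₀) :=
    (contDiffOn_one_iff_derivWithin (uniqueDiffOn_Ici t₀)).2
      ⟨hLd, (hX.continuousOn.matrix_mul hLd.continuousOn).congr hL'⟩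
  refine ⟨L, ?_, hL', fun t ht => sub_eq_zero.1 ?_⟩
  · rw [show (2 : WithTop ℕ∞) = 1 + 1 by norm_num,
      contDiffOn_succ_iff_derivWithin (uniqueDiffOn_Ici t₀)]
    exact ⟨hLd, by simp, (hX.matrix_mul hL1).congr hL'⟩
  · refine eq_zero_of_hasDerivWithinAt_Ici_of_norm_le (c := fun t => 2 * ‖X t‖)
      (x := fun t => L t * (L t)ᵀ - Λ t)
      (x' := fun t => X t * (L t * (L t)ᵀ - Λ t) + (L t * (L t)ᵀ - Λ t) * (X t)ᵀ)
      (continuousOn_const.mul hX.continuousOn.norm) (fun τ hτ => ?_) (fun τ _ => ?_)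
      (by rw [hL₀, hC, sub_self]) t ht
    · refine (((hL τ hτ).matrix_mul (hL τ hτ).matrix_transpose).sub (hΛ τ hτ)).congr_deriv ?_
      rw [transpose_mul]
      noncomm_ring
    · refine (norm_add_le_of_le (frobenius_norm_mul _ _) (frobenius_norm_mul _ _)).trans_eq ?_
      rw [frobenius_norm_transpose]
      ring

end Existence

/-- simultaneous elimination of gyroscopic and non-conservative positional
structures.  For `k ∈ {0,1,2}`, `A` of class `C¹` and `B` continuous, the system
`ẍ + A(t)ẋ + B(t)x = 0` is `L_k`-equivalent to some system `ξ̈ + V(t)ξ̇ + W(t)ξ = 0` with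
`V, W` continuous, `V(t)` and `W(t)` symmetric, iff there are a symmetric `C¹` function `S`
and a symmetric positive definite `S₀` such that, with `Λ(t) = 2∫_{t₀}^t S + S₀`,
`K(t) = (Λ(t)A(t)ᵀ − A(t)Λ(t))/4` and `M(t) = (1/2)Ȧ(t) + (1/4)A(t)² − B(t)`:
(1) `|tr Λ(t)| ≤ μ²` and `det Λ(t) ≥ η²` on `[t₀,∞)` for some `μ, η > 0`;
(2) if `k ≥ 1`, the derivatives of `K` and `S` of order `< k` are bounded on `[t₀,∞)`;
(3) `Λ(t)M(t)ᵀ = M(t)Λ(t)` for all `t ≥ t₀`. -/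
theorem stmt_7 {m : ℕ} (t₀ : ℝ) (k : ℕ) (hk : k = 0 ∨ k = 1 ∨ k = 2)
    (A B : ℝ → Matrix (Fin m) (Fin m) ℝ)
    (hA : ContDiffOn ℝ 1 A (Ici t₀)) (hB : ContinuousOn B (Ici t₀)) :
    (∃ V W : ℝ → Matrix (Fin m) (Fin m) ℝ,
        ContinuousOn V (Ici t₀) ∧ ContinuousOn W (Ici t₀) ∧
        (∀ t ∈ Ici t₀, (V t)ᵀ = V t) ∧ (∀ t ∈ Ici t₀, (W t)ᵀ = W t) ∧
        LkEquiv t₀ k A B V W) ↔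
      (∃ S : ℝ → Matrix (Fin m) (Fin m) ℝ, ∃ S₀ : Matrix (Fin m) (Fin m) ℝ,
        ContDiffOn ℝ 1 S (Ici t₀) ∧ (∀ t ∈ Ici t₀, (S t)ᵀ = S t) ∧ S₀.PosDef ∧
        (∃ μ > (0:ℝ), ∃ η > (0:ℝ),
          (∀ t ∈ Ici t₀, |(Lam t₀ S S₀ t).trace| ≤ μ ^ 2) ∧
          (∀ t ∈ Ici t₀, η ^ 2 ≤ (Lam t₀ S S₀ t).det)) ∧
        (1 ≤ k → ∀ i < k,
          (∃ M : ℝ, ∀ t ∈ Ici t₀,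
            ‖iteratedDerivWithin i
              (fun τ => (1/4 : ℝ) • (Lam t₀ S S₀ τ * (A τ)ᵀ - A τ * Lam t₀ S S₀ τ))
              (Ici t₀) t‖ ≤ M) ∧
          (∃ M : ℝ, ∀ t ∈ Ici t₀, ‖iteratedDerivWithin i S (Ici t₀) t‖ ≤ M)) ∧
        (∀ t ∈ Ici t₀,
          Lam t₀ S S₀ t *
              ((1/2 : ℝ) • derivWithin A (Ici t₀) t + (1/4 : ℝ) • (A t ^ 2) - B t)ᵀ
            = ((1/2 : ℝ) • derivWithin A (Ici t₀) t + (1/4 : ℝ) • (A t ^ 2) - B t)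
                * Lam t₀ S S₀ t)) := by
  constructor
  · rintro ⟨V, W, -, -, hV, hW, L, ⟨hL, ⟨η, hη, hdet⟩, hbdd⟩, hVW⟩
    have hu : ∀ t ∈ Ici t₀, IsUnit (L t).det := fun t ht =>
      isUnit_iff_ne_zero.2 (abs_pos.1 (hη.trans_le (hdet t ht)))
    have hskew : ∀ t ∈ Ici t₀, derivWithin L (Ici t₀) t * (L t)ᵀ
        - L t * (derivWithin L (Ici t₀) t)ᵀ
        = (1 / 2 : ℝ) • (L t * (L t)ᵀ * (A t)ᵀ - A t * (L t * (L t)ᵀ)) := fun t ht => by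
      rw [← isSymm_damping_iff (hu t ht), ← (hVW t ht).1, hV t ht]
    set S : ℝ → Matrix (Fin m) (Fin m) ℝ := fun t => (1 / 2 : ℝ) •
      (derivWithin L (Ici t₀) t * (L t)ᵀ + L t * (derivWithin L (Ici t₀) t)ᵀ) with hSdef
    have hL1 : ContDiffOn ℝ 1 L (Ici t₀) := hL.of_le one_le_two
    have hS : ContDiffOn ℝ 1 S (Ici t₀) :=
      ((hL.derivWithin_Ici.matrix_mul hL1.matrix_transpose).add
        (hL1.matrix_mul hL.derivWithin_Ici.matrix_transpose)).const_smul _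
    have hLam : EqOn (Lam t₀ S (L t₀ * (L t₀)ᵀ)) (fun t => L t * (L t)ᵀ) (Ici t₀) :=
      Lam_eqOn_of_hasDerivWithinAt hS.continuousOn rfl fun t ht =>
        (hasDerivWithinAt_mul_transpose_self hL t ht).congr_deriv (by simp only [hSdef]; module)
    have hK : EqOn (fun τ => (1 / 4 : ℝ) • (Lam t₀ S (L t₀ * (L t₀)ᵀ) τ * (A τ)ᵀ
        - A τ * Lam t₀ S (L t₀ * (L t₀)ᵀ) τ)) (fun t => (1 / 2 : ℝ) •
        (derivWithin L (Ici t₀) t * (L t)ᵀ - L t * (derivWithin L (Ici t₀) t)ᵀ)) (Ici t₀) :=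
      fun t ht => by
        simp only [hskew t ht, hLam ht]
        module
    obtain ⟨hb, hb'⟩ := (normBddOn_iteratedDerivWithin_iff hL hK (fun _ _ => rfl) hη hdet hk).1 hbdd
    obtain ⟨μ, hμ, htr⟩ := normBddOn_iff_mul_transpose_trace.1 hb
    refine ⟨S, L t₀ * (L t₀)ᵀ, hS, fun t _ => ?_,
      Matrix.posDef_mul_transpose_self (hu t₀ self_mem_Ici),
      ⟨μ, hμ, η, hη, fun t ht => ?_, fun t ht => ?_⟩, hb', fun t ht => ?_⟩
    · simp [hSdef, add_comm]
    · rw [hLam ht]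
      exact htr t ht
    · rw [hLam ht, Matrix.det_mul, Matrix.det_transpose, ← pow_two, ← sq_abs (L t).det]
      exact pow_le_pow_left₀ hη.le (hdet t ht) 2
    · rw [hLam ht]
      refine (isSymm_stiffness_iff (hu t ht) (hskew t ht)
        (derivWithin_skew_relation hL hA hskew t ht)).1 ?_
      rw [← (hVW t ht).2, hW t ht]
  · rintro ⟨S, S₀, hS, hSsymm, hS₀, ⟨μ, hμ, η, hη, htr, hdet⟩, hbdd, hM⟩
    have hLam' := hasDerivWithinAt_Lam (S₀ := S₀) hS.continuousOn
    have hS₀t : S₀ᵀ = S₀ := by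
      simpa only [Matrix.conjTranspose_eq_transpose_of_trivial] using hS₀.isHermitian.eq
    have hLamt := transpose_Lam hS.continuousOn hSsymm hS₀t
    have hLamu : ∀ t ∈ Ici t₀, IsUnit (Lam t₀ S S₀ t).det := fun t ht =>
      isUnit_iff_ne_zero.2 ((pow_pos hη 2).trans_le (hdet t ht)).ne'
    have hLam1 : ContDiffOn ℝ 1 (Lam t₀ S S₀) (Ici t₀) :=
      (contDiffOn_one_iff_derivWithin (uniqueDiffOn_Ici t₀)).2
        ⟨fun t ht => (hLam' t ht).differentiableWithinAt,
          (hS.continuousOn.const_smul (2 : ℝ)).congr fun t ht =>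
            (hLam' t ht).derivWithin (uniqueDiffOn_Ici t₀ t ht)⟩
    set K : ℝ → Matrix (Fin m) (Fin m) ℝ :=
      fun τ => (1 / 4 : ℝ) • (Lam t₀ S S₀ τ * (A τ)ᵀ - A τ * Lam t₀ S S₀ τ) with hKdef
    have hK : ContDiffOn ℝ 1 K (Ici t₀) :=
      ((hLam1.matrix_mul hA.matrix_transpose).sub (hA.matrix_mul hLam1)).const_smul _
    have hKt : ∀ t ∈ Ici t₀, (K t)ᵀ = -K t := fun t ht => by
      simp only [hKdef, transpose_smul, transpose_sub, transpose_mul, transpose_transpose,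
        hLamt t ht]
      module
    have hX : ContDiffOn ℝ 1 (fun t => (S t + K t) * (Lam t₀ S S₀ t)⁻¹) (Ici t₀) :=
      (hS.add hK).matrix_mul (hLam1.matrix_inv hLamu)
    obtain ⟨L, hL, hL', hLL⟩ := exists_mul_transpose_self_eq hX (Λ := Lam t₀ S S₀)
      (fun t ht => (hLam' t ht).congr_deriv (by
        rw [transpose_mul, transpose_nonsing_inv, hLamt t ht,
          Matrix.nonsing_inv_mul_cancel_right _ _ (hLamu t ht),
          Matrix.mul_nonsing_inv_cancel_left _ _ (hLamu t ht), transpose_add, hSsymm t ht,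
          hKt t ht]
        module)) (by rw [Lam_self]; exact hS₀.posSemidef)
    have hP : ∀ t ∈ Ici t₀, derivWithin L (Ici t₀) t * (L t)ᵀ = S t + K t := fun t ht => by
      rw [hL' t ht, Matrix.mul_assoc, hLL t ht,
        Matrix.nonsing_inv_mul_cancel_right _ _ (hLamu t ht)]
    have hPt : ∀ t ∈ Ici t₀, L t * (derivWithin L (Ici t₀) t)ᵀ = S t - K t := fun t ht => by
      rw [← transpose_transpose (L t), ← transpose_mul, hP t ht,
        transpose_add, hSsymm t ht, hKt t ht, sub_eq_add_neg]
    have hskew : ∀ t ∈ Ici t₀, derivWithin L (Ici t₀) t * (L t)ᵀ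
        - L t * (derivWithin L (Ici t₀) t)ᵀ
        = (1 / 2 : ℝ) • (L t * (L t)ᵀ * (A t)ᵀ - A t * (L t * (L t)ᵀ)) := fun t ht => by
      rw [hP t ht, hPt t ht, hLL t ht]
      simp only [hKdef]
      module
    have hLdet : ∀ t ∈ Ici t₀, η ≤ |(L t).det| := fun t ht => by
      have h := hdet t ht
      rw [← hLL t ht, Matrix.det_mul, Matrix.det_transpose, ← pow_two, ← sq_abs (L t).det] at h
      exact le_of_sq_le_sq h (abs_nonneg _)
    have hu : ∀ t ∈ Ici t₀, IsUnit (L t).det := fun t ht =>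
      isUnit_iff_ne_zero.2 (abs_pos.1 (hη.trans_le (hLdet t ht)))
    have hL1 : ContDiffOn ℝ 1 L (Ici t₀) := hL.of_le one_le_two
    have hLinv := (hL1.matrix_inv hu).continuousOn
    have hL'c := hL.derivWithin_Ici.continuousOn
    have hL''c := ((contDiffOn_one_iff_derivWithin (uniqueDiffOn_Ici t₀)).1 hL.derivWithin_Ici).2
    have hAc := hA.continuousOn
    have hLc := hL.continuousOn
    refine ⟨_, _, hLinv.matrix_mul ((hL'c.const_smul (2 : ℝ)).add (hAc.matrix_mul hLc)),
      hLinv.matrix_mul ((hL''c.add (hAc.matrix_mul hL'c)).add (hB.matrix_mul hLc)),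
      fun t ht => (isSymm_damping_iff (hu t ht)).2 (hskew t ht), fun t ht => ?_, L,
      ⟨hL, ⟨η, hη, hLdet⟩, ?_⟩, fun t _ => ⟨rfl, rfl⟩⟩
    · refine (isSymm_stiffness_iff (hu t ht) (hskew t ht)
        (derivWithin_skew_relation hL hA hskew t ht)).2 ?_
      rw [hLL t ht]
      exact hM t ht
    · refine (normBddOn_iteratedDerivWithin_iff hL (fun t ht => ?_) (fun t ht => ?_) hη hLdet hk).2
        ⟨normBddOn_iff_mul_transpose_trace.2 ⟨μ, hμ, fun t ht => ?_⟩, hbdd⟩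
      · simp only [hP t ht, hPt t ht]
        module
      · simp only [hP t ht, hPt t ht]
        module
      · rw [hLL t ht]
        exact htr t ht
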